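/- Let (X,d) be a proper metric space (every closed bounded subset is compact), let Ω ⊆ X be open, and let V denote the set of Lipschitz functions f : X → ℝ whose support is compact and contained in Ω. Let L : V → ℝ satisfy L(f+g) = L(f) + L(g) and L(λf) = λ·L(f) for all f,g ∈ V and λ ∈ ℝ, and L(f) ≥ 0 whenever f ∈ V is nonnegative. Then there exists a nonnegative Borel measure μ on Ω, finite on every compact subset of Ω, such that L(f) = ∫ f dμ for every f ∈ V. -/

import Mathlib

open Real MeasureTheory

/-- The test functions on an open set `Ω`: Lipschitz functions `X → ℝ` with compact
support contained in `Ω`. -/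
def testFunctions {X : Type*} [MetricSpace X] (Ω : Set X) : Set (X → ℝ) :=
  {f | (∃ C : NNReal, LipschitzWith C f) ∧ IsCompact (tsupport f) ∧ tsupport f ⊆ Ω}

open scoped CompactlySupported

/-- A version of the **M. Riesz extension theorem** in which the functional is defined on the
source of a linear map with cofinal range. -/
theorem riesz_extension_of_linearMap {E V : Type*} [AddCommGroup E] [Module ℝ E] [AddCommGroup V]
    [Module ℝ V] (s : PointedCone ℝ E) (r : V →ₗ[ℝ] E) (l : V →ₗ[ℝ] ℝ)
    (hpos : ∀ v, r v ∈ s → 0 ≤ l v) (hcof : ∀ e, ∃ v, r v + e ∈ s) :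
    ∃ Λ : E →ₗ[ℝ] ℝ, (∀ v, Λ (r v) = l v) ∧ ∀ e ∈ s, 0 ≤ Λ e := by
  obtain ⟨i, hi⟩ := r.rangeRestrict.exists_rightInverse_of_surjective r.range_rangeRestrict
  have hri : ∀ w : LinearMap.range r, r (i w) = w := fun w =>
    congrArg Subtype.val (LinearMap.congr_fun hi w)
  have hli : ∀ v, l (i (r.rangeRestrict v)) = l v := by
    intro v
    have h : r (i (r.rangeRestrict v)) = r v := hri _
    have h₁ := hpos (i (r.rangeRestrict v) - v) (by rw [map_sub, h, sub_self]; exact s.zero_mem)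
    have h₂ := hpos (v - i (r.rangeRestrict v)) (by rw [map_sub, h, sub_self]; exact s.zero_mem)
    rw [map_sub] at h₁ h₂
    linarith
  obtain ⟨Λ, hΛ, hΛpos⟩ := riesz_extension s ⟨LinearMap.range r, l ∘ₗ i⟩
    (fun w hw => hpos _ (by rw [hri]; exact hw))
    (fun e => (hcof e).imp' r.rangeRestrict fun _ hv => hv)
  exact ⟨Λ, fun v => (hΛ (r.rangeRestrict v)).trans (hli v), hΛpos⟩

/-- A linear functional which is nonnegative whenever the image in `C_c(Y, ℝ)` is nonnegative is
represented by a regular measure, as soon as the image is cofinal in `C_c(Y, ℝ)`. -/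
theorem exists_regular_measure_of_cofinal {Y V : Type*} [TopologicalSpace Y] [T2Space Y]
    [LocallyCompactSpace Y] [MeasurableSpace Y] [BorelSpace Y] [AddCommGroup V] [Module ℝ V]
    (r : V →ₗ[ℝ] C_c(Y, ℝ)) (l : V →ₗ[ℝ] ℝ) (hpos : ∀ v, 0 ≤ r v → 0 ≤ l v)
    (hcof : ∀ g : C_c(Y, ℝ), ∃ v, g ≤ r v) :
    ∃ μ : Measure Y, μ.Regular ∧ ∀ v, l v = ∫ y, r v y ∂μ := by
  have : PosSMulMono ℝ C_c(Y, ℝ) :=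
    ⟨fun _ hc _ _ h y => mul_le_mul_of_nonneg_left (h y) hc⟩
  obtain ⟨Λ, hΛ, hΛpos⟩ := riesz_extension_of_linearMap (PointedCone.positive ℝ C_c(Y, ℝ)) r l
    hpos (fun g => (hcof (-g)).imp fun _ hv => neg_le_iff_add_nonneg.1 hv)
  refine ⟨RealRMK.rieszMeasure (PositiveLinearMap.mk₀ Λ hΛpos), inferInstance, fun v => ?_⟩
  rw [RealRMK.integral_rieszMeasure]
  exact (hΛ v).symm

/-- The space of test functions on `Ω`, as a submodule. -/
def testFunctionsSubmodule {X : Type*} [MetricSpace X] (Ω : Set X) : Submodule ℝ (X → ℝ) where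
  carrier := testFunctions Ω
  zero_mem' := by
    have h : tsupport (0 : X → ℝ) = ∅ := tsupport_eq_empty_iff.2 rfl
    refine ⟨⟨0, LipschitzWith.const 0⟩, ?_, ?_⟩ <;> simp [h]
  add_mem' := by
    rintro f g ⟨⟨C, hC⟩, hf, hfΩ⟩ ⟨⟨D, hD⟩, hg, hgΩ⟩
    exact ⟨⟨C + D, hC.add hD⟩, HasCompactSupport.add hf hg,
      (tsupport_add f g).trans (Set.union_subset hfΩ hgΩ)⟩
  smul_mem' := by
    rintro c f ⟨⟨C, hC⟩, hf, hfΩ⟩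
    refine ⟨⟨_, (lipschitzWith_smul c).comp hC⟩, ?_, ?_⟩
    · exact HasCompactSupport.smul_left (f := fun _ => c) hf
    · exact (tsupport_smul_subset_right (fun _ => c) f).trans hfΩ

/-- Restriction of test functions on `Ω` to compactly supported functions on the subtype `Ω`. -/
def restrictTestFunctions {X : Type*} [MetricSpace X] (Ω : Set X) :
    testFunctionsSubmodule Ω →ₗ[ℝ] C_c(Ω, ℝ) where
  toFun f :=
    { toFun := fun x => f.1 x
      continuous_toFun := f.2.1.choose_spec.continuous.comp continuous_subtype_val
      hasCompactSupport' := by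
        obtain ⟨f, -, hf, hfΩ⟩ := f
        refine HasCompactSupport.intro' (K := Subtype.val ⁻¹' tsupport f) ?_
          ((isClosed_tsupport f).preimage continuous_subtype_val)
          fun x hx => image_eq_zero_of_notMem_tsupport hx
        exact Topology.IsInducing.subtypeVal.isCompact_preimage_iff (by simpa using hfΩ) |>.2 hf }
  map_add' _ _ := rfl
  map_smul' _ _ := rfl

theorem exists_le_restrictTestFunctions {X : Type*} [MetricSpace X] [ProperSpace X] {Ω : Set X}
    (hΩ : IsOpen Ω) (g : C_c(Ω, ℝ)) : ∃ f, g ≤ restrictTestFunctions Ω f := by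
  have hK : IsCompact (Subtype.val '' tsupport g) :=
    IsCompact.image g.hasCompactSupport continuous_subtype_val
  obtain ⟨δ, hδ, hδΩ⟩ := hK.exists_cthickening_subset_open hΩ (by rintro _ ⟨x, -, rfl⟩; exact x.2)
  obtain ⟨M, hM⟩ := HasCompactSupport.exists_bound_of_continuous g.hasCompactSupport g.continuous
  set φ : X → ℝ := fun x => thickenedIndicator hδ (Subtype.val '' tsupport g) x
  have hsupp : tsupport φ ⊆ Metric.cthickening δ (Subtype.val '' tsupport g) := by
    refine (closure_mono fun x hx => ?_).trans (Metric.closure_thickening_subset_cthickening _ _)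
    by_contra h
    exact hx (congrArg NNReal.toReal (thickenedIndicator_zero hδ _ h))
  have hmem : φ ∈ testFunctionsSubmodule Ω :=
    ⟨⟨_, LipschitzWith.subtype_val _ |>.comp (lipschitzWith_thickenedIndicator hδ _)⟩,
      hK.cthickening.of_isClosed_subset (isClosed_tsupport φ) hsupp, hsupp.trans hδΩ⟩
  refine ⟨|M| • ⟨φ, hmem⟩, fun x => ?_⟩
  change g x ≤ |M| * φ x
  by_cases hx : x ∈ tsupport g
  · have h : φ x = 1 :=
      congrArg NNReal.toReal (thickenedIndicator_one hδ _ (Set.mem_image_of_mem _ hx))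
    rw [h, mul_one]
    exact (le_abs_self _).trans ((hM x).trans (le_abs_self M))
  · rw [image_eq_zero_of_notMem_tsupport hx]
    exact mul_nonneg (abs_nonneg _) (NNReal.coe_nonneg _)

/-- Riesz-type representation: on a proper metric space, a linear positive functional on
the space of compactly supported Lipschitz functions with support in an open set `Ω` is
represented by a nonnegative Borel measure on `Ω` which is finite on compact subsets
of `Ω`. -/
theorem riesz_representation_of_positive_linear
    {X : Type*} [MetricSpace X] [ProperSpace X] [MeasurableSpace X] [BorelSpace X]
    (Ω : Set X) (hΩ : IsOpen Ω)
    (L : (X → ℝ) → ℝ)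
    (hadd : ∀ f g : X → ℝ, f ∈ testFunctions Ω → g ∈ testFunctions Ω → L (f + g) = L f + L g)
    (hsmul : ∀ (c : ℝ) (f : X → ℝ), f ∈ testFunctions Ω → L (c • f) = c * L f)
    (hpos : ∀ f ∈ testFunctions Ω, (∀ x, 0 ≤ f x) → 0 ≤ L f) :
    ∃ μ : Measure X, μ Ωᶜ = 0 ∧
      (∀ K : Set X, K ⊆ Ω → IsCompact K → μ K < ⊤) ∧
      ∀ f ∈ testFunctions Ω, L f = ∫ x, f x ∂μ := by
  let l : testFunctionsSubmodule Ω →ₗ[ℝ] ℝ :=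
    { toFun := fun f => L f
      map_add' := fun f g => hadd f g f.2 g.2
      map_smul' := fun c f => hsmul c f f.2 }
  have hzero : ∀ f ∈ testFunctions Ω, ∀ x ∉ Ω, f x = 0 := fun f hf x hx =>
    image_eq_zero_of_notMem_tsupport fun h => hx (hf.2.2 h)
  have : LocallyCompactSpace Ω := hΩ.locallyCompactSpace
  obtain ⟨μ, hμ, hint⟩ := exists_regular_measure_of_cofinal (restrictTestFunctions Ω) l
    (fun f hf => hpos f f.2 fun x => by
      by_cases hx : x ∈ Ω
      · exact hf ⟨x, hx⟩
      · exact (hzero f f.2 x hx).ge)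
    (exists_le_restrictTestFunctions hΩ)
  have hemb : MeasurableEmbedding (Subtype.val : Ω → X) := .subtype_coe hΩ.measurableSet
  refine ⟨μ.map Subtype.val, ?_, fun K hKΩ hK => ?_, fun f hf => ?_⟩
  · rw [hemb.map_apply]
    simp
  · rw [hemb.map_apply]
    exact (Topology.IsInducing.subtypeVal.isCompact_preimage_iff
      (by simpa using hKΩ) |>.2 hK).measure_lt_top
  · rw [hemb.integral_map]
    exact hint ⟨f, hf⟩
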